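/- Let β > 0 and δ > 0, and let X and S be independent real-valued random variables with X exponentially distributed with rate β and S exponentially distributed with rate δ. Then E[min(X, S)] / P(X > S) = 1/δ. -/

import Mathlib

open MeasureTheory ProbabilityTheory

lemma aux_tail {r : ℝ} (hr : 0 < r) {x : ℝ} (hx : 0 ≤ x) :
    expMeasure r (Set.Ioi x) = ENNReal.ofReal (Real.exp (-(r * x))) := by
  have := isProbabilityMeasure_expMeasure hr
  have h := cdf_expMeasure_eq hr x
  rw [if_pos hx, cdf_eq_real] at h
  have h2 : (expMeasure r).real (Set.Ioi x) = Real.exp (-(r * x)) := by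
    rw [← Set.compl_Iic, probReal_compl_eq_one_sub measurableSet_Iic, h]
    ring
  rw [← h2, ofReal_measureReal]

lemma aux_nonneg {r : ℝ} (hr : 0 < r) : ∀ᵐ x ∂(expMeasure r), 0 ≤ x := by
  have := isProbabilityMeasure_expMeasure hr
  have h : expMeasure r (Set.Ioi 0) = 1 := by
    rw [aux_tail hr le_rfl]; simp
  have h2 : ∀ᵐ x ∂(expMeasure r), x ∈ Set.Ioi (0:ℝ) :=
    (mem_ae_iff_prob_eq_one measurableSet_Ioi).2 h
  filter_upwards [h2] with x hx using le_of_lt hx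

lemma aux_int {c : ℝ} (hc : 0 < c) :
    ∫⁻ t in Set.Ioi (0:ℝ), ENNReal.ofReal (Real.exp (-(c * t))) = ENNReal.ofReal (1 / c) := by
  have hi : IntegrableOn (fun t : ℝ => Real.exp (-(c * t))) (Set.Ioi 0) := by
    simpa only [neg_mul] using exp_neg_integrableOn_Ioi 0 hc
  rw [← ofReal_integral_eq_lintegral_ofReal hi (Filter.Eventually.of_forall fun t => (Real.exp_pos _).le)]
  congr 1
  have := integral_exp_mul_Ioi (a := -c) (by linarith) 0
  simp only [neg_mul] at this
  rw [this]
  simp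

/-- The stationary average relative age of information of the M/M/1/1-PO server:
`E[min(X, S)]/P(X > S) = 1/δ` for independent exponentials `X` (rate `β`), `S` (rate `δ`). -/
theorem relative_aoi_M_M_1_1_PO {Ω : Type*} [MeasureSpace Ω]
    [IsProbabilityMeasure (ℙ : Measure Ω)]
    (β δ : ℝ) (hβ : 0 < β) (hδ : 0 < δ)
    (X S : Ω → ℝ) (hXm : Measurable X) (hSm : Measurable S)
    (hXd : (ℙ : Measure Ω).map X = expMeasure β)
    (hSd : (ℙ : Measure Ω).map S = expMeasure δ)
    (hind : IndepFun X S ℙ) :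
    (∫ ω, min (X ω) (S ω)) / (ℙ {ω | X ω > S ω}).toReal = 1 / δ := by
  have := isProbabilityMeasure_expMeasure hβ
  have := isProbabilityMeasure_expMeasure hδ
  have hc : 0 < β + δ := by positivity
  have hX0 : ∀ᵐ ω, 0 ≤ X ω := ae_of_ae_map hXm.aemeasurable (hXd ▸ aux_nonneg hβ)
  have hS0 : ∀ᵐ ω, 0 ≤ S ω := ae_of_ae_map hSm.aemeasurable (hSd ▸ aux_nonneg hδ)
  have hm0 : 0 ≤ᵐ[ℙ] fun ω => min (X ω) (S ω) := by
    filter_upwards [hX0, hS0] with ω h1 h2 using le_min h1 h2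
  have hmm : Measurable fun ω => min (X ω) (S ω) := hXm.min hSm
  have hE : ∫ ω, min (X ω) (S ω) = 1 / (β + δ) := by
    rw [integral_eq_lintegral_of_nonneg_ae hm0 hmm.aestronglyMeasurable,
      lintegral_eq_lintegral_meas_lt _ hm0 hmm.aemeasurable]
    have : ∀ t ∈ Set.Ioi (0:ℝ), ℙ {ω | t < min (X ω) (S ω)}
        = ENNReal.ofReal (Real.exp (-((β + δ) * t))) := by
      intro t ht
      have h1 : {ω | t < min (X ω) (S ω)} = X ⁻¹' Set.Ioi t ∩ S ⁻¹' Set.Ioi t := by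
        ext ω; simp
      rw [h1, hind.measure_inter_preimage_eq_mul _ _ measurableSet_Ioi measurableSet_Ioi,
        ← Measure.map_apply hXm measurableSet_Ioi, ← Measure.map_apply hSm measurableSet_Ioi,
        hXd, hSd, aux_tail hβ (le_of_lt ht), aux_tail hδ (le_of_lt ht),
        ← ENNReal.ofReal_mul (Real.exp_pos _).le, ← Real.exp_add]
      congr 2
      ring
    rw [setLIntegral_congr_fun measurableSet_Ioi this, aux_int hc,
      ENNReal.toReal_ofReal (by positivity)]
  have hP : ℙ {ω | X ω > S ω} = ENNReal.ofReal (δ * (1 / (β + δ))) := by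
    have hms : MeasurableSet {p : ℝ × ℝ | p.2 < p.1} := measurableSet_lt measurable_snd measurable_fst
    have h1 : {ω | X ω > S ω} = (fun ω => (X ω, S ω)) ⁻¹' {p : ℝ × ℝ | p.2 < p.1} := rfl
    rw [h1, ← Measure.map_apply (hXm.prodMk hSm) hms,
      (indepFun_iff_map_prod_eq_prod_map_map hXm.aemeasurable hSm.aemeasurable).1 hind,
      hXd, hSd, Measure.prod_apply_symm hms]
    have h2 : ∀ᵐ s ∂(expMeasure δ), expMeasure β ((fun x => (x, s)) ⁻¹' {p : ℝ × ℝ | p.2 < p.1})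
        = ENNReal.ofReal (Real.exp (-(β * s))) := by
      filter_upwards [aux_nonneg hδ] with s hs
      exact aux_tail hβ hs
    rw [lintegral_congr_ae h2]
    have h3 : expMeasure δ = volume.withDensity (exponentialPDF δ) := rfl
    have hpm : Measurable (exponentialPDF δ) :=
      (measurable_exponentialPDFReal δ).ennreal_ofReal
    rw [h3, lintegral_withDensity_eq_lintegral_mul _ hpm (by fun_prop),
      ENNReal.ofReal_mul hδ.le, ← aux_int hc, ← lintegral_const_mul _ (by fun_prop),
      setLIntegral_congr Ioi_ae_eq_Ici, ← lintegral_indicator measurableSet_Ici]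
    refine lintegral_congr fun s => ?_
    by_cases hs : 0 ≤ s
    · rw [Set.indicator_of_mem (Set.mem_Ici.2 hs), Pi.mul_apply, exponentialPDF_of_nonneg hs,
        ← ENNReal.ofReal_mul (by positivity), ← ENNReal.ofReal_mul hδ.le, mul_assoc,
        ← Real.exp_add]
      congr 3
      ring
    · rw [Set.indicator_of_notMem (by simpa using hs), Pi.mul_apply,
        exponentialPDF_of_neg (not_le.1 hs), zero_mul]
  rw [hE, hP, ENNReal.toReal_ofReal (by positivity)]
  field_simp
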